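/- There exists a constant c > 0 such that the following holds: for every finite alphabet Σ and every string T over Σ of length n ≥ 1 whose last character occurs exactly once in T, there exists a context-free grammar G over Σ in Chomsky normal form (every production is of the form X → YZ for nonterminals Y, Z, or X → a for a terminal a ∈ Σ) with at most c · ẽ_T productions whose generated language is exactly the singleton {T}. -/

import Mathlib

/-- The set of beginning positions (starting offsets) of occurrences of `x` in `T`. -/
def BegPos {α : Type*} [DecidableEq α] (T x : List α) : Finset ℕ :=
  (Finset.range (T.length + 1)).filter (fun i => x <+: T.drop i)

/-- The number of occurrences of `x` in `T`. -/
def occ {α : Type*} [DecidableEq α] (T x : List α) : ℕ := (BegPos T x).card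

/-- `w` is a maximal repeat of `T`: a repeat whose every right extension `w·a` and
every left extension `a·w` occurs strictly fewer times in `T` than `w`. -/
def IsMaxRep {α : Type*} [DecidableEq α] (T w : List α) : Prop :=
  2 ≤ occ T w ∧ ∀ a : α, occ T (w ++ [a]) < occ T w ∧ occ T (a :: w) < occ T w

/-- The set of right extensions of maximal repeats of `T`: substrings of `T`
of the form `w·a` with `w` a maximal repeat of `T` and `a` a character. -/
def RightExtSet {α : Type*} [DecidableEq α] (T : List α) : Set (List α) :=
  {x | ∃ (w : List α) (a : α), IsMaxRep T w ∧ x = w ++ [a] ∧ 1 ≤ occ T x}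

/-- The set of left extensions of maximal repeats of `T`: substrings of `T`
of the form `a·w` with `w` a maximal repeat of `T` and `a` a character. -/
def LeftExtSet {α : Type*} [DecidableEq α] (T : List α) : Set (List α) :=
  {x | ∃ (w : List α) (a : α), IsMaxRep T w ∧ x = a :: w ∧ 1 ≤ occ T x}

/-- A context-free grammar is in Chomsky normal form if every production rule is either
of the form `X → Y Z` for nonterminals `Y, Z`, or of the form `X → a` for a terminal `a`. -/
def InChomskyNF {σ : Type} (g : ContextFreeGrammar σ) : Prop :=
  ∀ r ∈ g.rules,
    (∃ a : σ, r.output = [Symbol.terminal a]) ∨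
    (∃ Y Z : g.NT, r.output = [Symbol.nonterminal Y, Symbol.nonterminal Z])

section Occurrences

variable {α : Type*} [DecidableEq α] {T : List α}

theorem mem_begPos_iff {x : List α} {i : ℕ} :
    i ∈ BegPos T x ↔ ∃ p s, p.length = i ∧ T = p ++ (x ++ s) := by
  simp only [BegPos, Finset.mem_filter, Finset.mem_range]
  constructor
  · rintro ⟨hi, s, hs⟩
    exact ⟨T.take i, s, by simp; omega, by rw [hs, List.take_append_drop]⟩
  · rintro ⟨p, s, rfl, hT⟩
    refine ⟨by rw [hT]; simp, s, by rw [hT]; simp⟩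

theorem occ_pos_iff {x : List α} : 1 ≤ occ T x ↔ ∃ p s, T = p ++ (x ++ s) := by
  rw [occ, Nat.succ_le_iff, Finset.card_pos]
  constructor
  · rintro ⟨i, hi⟩
    obtain ⟨p, s, -, h⟩ := mem_begPos_iff.1 hi
    exact ⟨p, s, h⟩
  · rintro ⟨p, s, h⟩
    exact ⟨p.length, mem_begPos_iff.2 ⟨p, s, rfl, h⟩⟩

theorem length_le_of_occ_pos {x : List α} (h : 1 ≤ occ T x) : x.length ≤ T.length := by
  obtain ⟨p, s, rfl⟩ := occ_pos_iff.1 h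
  simp; omega

theorem begPos_append_subset (x y : List α) : BegPos T (x ++ y) ⊆ BegPos T x := by
  intro i hi
  obtain ⟨p, s, hp, h⟩ := mem_begPos_iff.1 hi
  exact mem_begPos_iff.2 ⟨p, y ++ s, hp, by simpa using h⟩

theorem occ_append_right_le (x y : List α) : occ T (x ++ y) ≤ occ T x :=
  Finset.card_le_card (begPos_append_subset x y)

theorem occ_append_right_eq_iff {x y : List α} :
    occ T (x ++ y) = occ T x ↔ ∀ p s, T = p ++ (x ++ s) → y <+: s := by
  constructor
  · intro h p s hT
    have hEq := Finset.eq_of_subset_of_card_le (begPos_append_subset (T := T) x y) h.ge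
    have hmem : p.length ∈ BegPos T (x ++ y) := by
      rw [hEq]; exact mem_begPos_iff.2 ⟨p, s, rfl, hT⟩
    obtain ⟨p', s', hp, hT'⟩ := mem_begPos_iff.1 hmem
    rw [hT] at hT'
    obtain ⟨-, h2⟩ := List.append_inj hT' hp.symm
    rw [List.append_assoc] at h2
    exact ⟨s', (List.append_cancel_left h2).symm⟩
  · intro h
    refine congrArg Finset.card (Finset.Subset.antisymm (begPos_append_subset x y) fun i hi => ?_)
    obtain ⟨p, s, hp, hT⟩ := mem_begPos_iff.1 hi
    obtain ⟨t, rfl⟩ := h p s hT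
    exact mem_begPos_iff.2 ⟨p, t, hp, by simpa using hT⟩

theorem image_begPos_append_subset (x y : List α) :
    (BegPos T (x ++ y)).image (· + x.length) ⊆ BegPos T y := by
  intro i hi
  obtain ⟨j, hj, rfl⟩ := Finset.mem_image.1 hi
  obtain ⟨p, s, hp, h⟩ := mem_begPos_iff.1 hj
  exact mem_begPos_iff.2 ⟨p ++ x, s, by simp [hp], by simpa using h⟩

theorem card_image_begPos (x : List α) (k : ℕ) :
    ((BegPos T x).image (· + k)).card = occ T x :=
  Finset.card_image_of_injective _ (add_left_injective k)

theorem occ_append_left_le (x y : List α) : occ T (x ++ y) ≤ occ T y :=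
  card_image_begPos (T := T) (x ++ y) x.length ▸
    Finset.card_le_card (image_begPos_append_subset x y)

theorem occ_append_left_eq_iff {x y : List α} :
    occ T (x ++ y) = occ T y ↔ ∀ p s, T = p ++ (y ++ s) → x <:+ p := by
  constructor
  · intro h p s hT
    have hEq := Finset.eq_of_subset_of_card_le (image_begPos_append_subset (T := T) x y)
      (by rw [card_image_begPos]; exact h.ge)
    have hmem : p.length ∈ (BegPos T (x ++ y)).image (· + x.length) := by
      rw [hEq]; exact mem_begPos_iff.2 ⟨p, s, rfl, hT⟩
    obtain ⟨j, hj, hp⟩ := Finset.mem_image.1 hmem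
    obtain ⟨p', s', hp', hT'⟩ := mem_begPos_iff.1 hj
    have hT'' : p ++ (y ++ s) = (p' ++ x) ++ (y ++ s') := by rw [← hT, hT']; simp
    obtain ⟨h1, -⟩ := List.append_inj hT'' (by simp [← hp, hp'])
    exact ⟨p', h1.symm⟩
  · intro h
    have hEq : (BegPos T (x ++ y)).image (· + x.length) = BegPos T y := by
      refine Finset.Subset.antisymm (image_begPos_append_subset x y) fun i hi => ?_
      obtain ⟨p, s, hp, hT⟩ := mem_begPos_iff.1 hi
      obtain ⟨q, rfl⟩ := h p s hT
      exact Finset.mem_image.2 ⟨q.length, mem_begPos_iff.2 ⟨q, s, rfl, by simpa using hT⟩,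
        by simpa using hp⟩
    rw [← card_image_begPos (x ++ y) x.length, hEq, occ]

theorem occ_append_left_eq_append {x y : List α} (z : List α) (h : occ T (x ++ y) = occ T y) :
    occ T (x ++ (y ++ z)) = occ T (y ++ z) := by
  rw [occ_append_left_eq_iff] at h ⊢
  intro p s hT
  exact h p (z ++ s) (by simpa using hT)

theorem occ_nil : occ T [] = T.length + 1 := by
  simp [occ, BegPos]

theorem occ_lt_occ_nil {x : List α} (hx : x ≠ []) : occ T x < occ T [] := by
  refine lt_of_le_of_ne (occ_append_right_le [] x) fun h => hx ?_
  exact List.prefix_nil.1 (occ_append_right_eq_iff (x := []).1 h T [] (by simp))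

end Occurrences

section LeftClosure

variable {α : Type*} [DecidableEq α] {T : List α}

/-- `u` is the longest string such that every occurrence of `y` in `T` is preceded by `u`. -/
def IsLeftClosure (T y u : List α) : Prop :=
  occ T (u ++ y) = occ T y ∧ ∀ c, occ T (c :: (u ++ y)) < occ T (u ++ y)

theorem exists_isLeftClosure {y : List α} (hy : 1 ≤ occ T y) : ∃ u, IsLeftClosure T y u := by
  obtain ⟨k, hk⟩ : ∃ k, T.length ≤ y.length + k := ⟨T.length, by omega⟩
  induction k generalizing y with
  | zero =>
    refine ⟨[], rfl, fun c => ?_⟩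
    by_contra! h
    have := length_le_of_occ_pos (hy.trans h)
    simp at this; omega
  | succ k ih =>
    by_cases h : ∃ c, occ T (c :: y) = occ T y
    · obtain ⟨c, hc⟩ := h
      obtain ⟨u, hu, hmax⟩ := ih (y := c :: y) (hc ▸ hy) (by simp; omega)
      exact ⟨u ++ [c], by simpa [hc] using hu, by simpa using hmax⟩
    · push Not at h
      exact ⟨[], rfl, fun c => lt_of_le_of_ne (occ_append_left_le [c] y) (h c)⟩

theorem IsLeftClosure.suffix {y u v : List α} (hu : IsLeftClosure T y u)
    (hv : occ T (v ++ y) = occ T y) (hy : 1 ≤ occ T y) : v <:+ u := by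
  obtain ⟨p, s, hT⟩ := occ_pos_iff.1 hy
  have hup := occ_append_left_eq_iff.1 hu.1 p s hT
  have hvp := occ_append_left_eq_iff.1 hv p s hT
  rcases List.suffix_or_suffix_of_suffix hvp hup with h | ⟨q, hq⟩
  · exact h
  · rcases List.eq_nil_or_concat q with rfl | ⟨q, c, rfl⟩
    · simp at hq; rw [hq]
    · have h1 := occ_append_left_le (T := T) q (c :: (u ++ y))
      have h2 := hu.2 c
      have h3 := hu.1
      have h4 : q ++ c :: (u ++ y) = v ++ y := by rw [← hq]; simp
      rw [h4] at h1
      omega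

theorem IsLeftClosure.unique {y u v : List α} (hy : 1 ≤ occ T y) (hu : IsLeftClosure T y u)
    (hv : IsLeftClosure T y v) : u = v :=
  have h1 := hu.suffix hv.1 hy
  have h2 := hv.suffix hu.1 hy
  h2.eq_of_length (le_antisymm h2.length_le h1.length_le)

open Classical in
/-- The longest string that precedes every occurrence of `y` in `T`. -/
noncomputable def leftClosure (T y : List α) : List α :=
  if h : ∃ u, IsLeftClosure T y u then h.choose else []

theorem isLeftClosure_leftClosure {y : List α} (hy : 1 ≤ occ T y) :
    IsLeftClosure T y (leftClosure T y) := by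
  have h := exists_isLeftClosure hy
  rw [leftClosure, dif_pos h]
  exact h.choose_spec

theorem IsLeftClosure.eq_leftClosure {y u : List α} (hu : IsLeftClosure T y u)
    (hy : 1 ≤ occ T y) : leftClosure T y = u :=
  (isLeftClosure_leftClosure hy).unique hy hu

theorem IsLeftClosure.append_right {y t u : List α} (hu : IsLeftClosure T (y ++ t) u)
    (h : occ T (y ++ t) = occ T y) : IsLeftClosure T y u := by
  have key : ∀ v, occ T (v ++ (y ++ t)) = occ T (v ++ y) := by
    intro v
    have h' := occ_append_right_eq_iff.1 h
    rw [← List.append_assoc, occ_append_right_eq_iff]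
    intro p s hT
    exact h' (p ++ v) s (by simpa using hT)
  refine ⟨?_, fun c => ?_⟩
  · rw [← key, hu.1, h]
  · have := hu.2 c
    rwa [key, ← List.cons_append, key, List.cons_append] at this

/-- The left closure of `y` followed by the first character of `y`. -/
noncomputable def closureHead (T y : List α) : List α :=
  leftClosure T y ++ y.take 1

/-- Shortest representatives of the right extensions of maximal repeats: strings `x·a` such that
`x` is right-maximal and is the shortest string having the left closure it has. -/
def IsKey (T z : List α) : Prop :=
  ∃ x a, z = x ++ [a] ∧ 1 ≤ occ T z ∧ occ T z < occ T x ∧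
    ∀ c t, x = c :: t → occ T x < occ T t

/-- A nonempty substring has a prefix `x·a` with as many occurrences and `x` right-maximal. -/
theorem exists_rightMaximal_prefix {y : List α} (hy : y ≠ []) :
    ∃ x a t, y = x ++ [a] ++ t ∧ occ T (x ++ [a]) = occ T y ∧ occ T y < occ T x := by
  induction y using List.reverseRecOn with
  | nil => exact absurd rfl hy
  | append_singleton y b ih =>
    rcases (occ_append_right_le (T := T) y [b]).lt_or_eq with h | h
    · exact ⟨y, b, [], by simp, rfl, h⟩
    · have hne : y ≠ [] := by
        rintro rfl
        exact (occ_lt_occ_nil (T := T) (x := [] ++ [b]) (by simp)).ne h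
      obtain ⟨x, a, t, rfl, h1, h2⟩ := ih hne
      exact ⟨x, a, t ++ [b], by simp, by rw [h1, h], by rw [h]; exact h2⟩

/-- If no proper prefix of `y` can lose its first character without gaining occurrences,
then `closureHead T y` is attained at a key. -/
theorem exists_isKey_closureHead {y : List α} (hne : y ≠ []) (hy : 1 ≤ occ T y)
    (h : ∀ c x t, y = c :: (x ++ t) → t ≠ [] → occ T (c :: x) ≠ occ T x) :
    ∃ z, IsKey T z ∧ z <+: y ∧ closureHead T z = closureHead T y := by
  obtain ⟨x, a, t, rfl, h1, h2⟩ := exists_rightMaximal_prefix (T := T) hne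
  refine ⟨x ++ [a], ⟨x, a, rfl, h1 ▸ hy, h1 ▸ h2, ?_⟩, List.prefix_append _ _, ?_⟩
  · rintro c u rfl
    exact lt_of_le_of_ne (occ_append_left_le [c] u) (h c u ([a] ++ t) (by simp) (by simp))
  · have := (isLeftClosure_leftClosure hy).append_right h1.symm
    rw [closureHead, this.eq_leftClosure (h1 ▸ hy), closureHead]
    cases x <;> simp

theorem IsKey.occ_pos {z : List α} (hz : IsKey T z) : 1 ≤ occ T z := by
  obtain ⟨_, _, _, h, _⟩ := hz
  exact h

theorem isKey_singleton {a : α} (ha : 1 ≤ occ T [a]) : IsKey T [a] :=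
  ⟨[], a, rfl, ha, occ_lt_occ_nil (by simp), by simp⟩

theorem leftClosure_nil : leftClosure T ([] : List α) = [] := by
  refine IsLeftClosure.eq_leftClosure ⟨rfl, fun c => ?_⟩ (by simp [occ_nil])
  exact occ_lt_occ_nil (by simp)

/-- The strings of the grammar: closure heads of keys, and single characters. -/
def IsPiece (T s : List α) : Prop :=
  (∃ z, IsKey T z ∧ s = closureHead T z) ∨ ∃ a, s = [a] ∧ IsKey T [a]

theorem IsKey.closureHead_ne_nil {z : List α} (hz : IsKey T z) : closureHead T z ≠ [] := by
  obtain ⟨x, a, rfl, -⟩ := hz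
  cases x <;> simp [closureHead]

theorem IsPiece.ne_nil {s : List α} (hs : IsPiece T s) : s ≠ [] := by
  rcases hs with ⟨z, hz, rfl⟩ | ⟨a, rfl, -⟩
  · exact hz.closureHead_ne_nil
  · simp

/-- The part of the left closure of `x·a` that goes beyond the left closure of `x` is a piece. -/
theorem isPiece_of_leftClosure_eq {x v : List α} {a : α} (hz : 1 ≤ occ T (x ++ [a]))
    (hv : v ≠ []) (h : leftClosure T (x ++ [a]) = v ++ leftClosure T x) : IsPiece T v := by
  obtain ⟨q, c, rfl⟩ := (List.eq_nil_or_concat v).resolve_left hv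
  have hx : 1 ≤ occ T x := hz.trans (occ_append_right_le x [a])
  have hcx := isLeftClosure_leftClosure hx
  have hcz := isLeftClosure_leftClosure hz
  set w := leftClosure T x ++ x with hw
  have hq : IsLeftClosure T (c :: (w ++ [a])) q := by
    have e : q ++ c :: (w ++ [a]) = leftClosure T (x ++ [a]) ++ (x ++ [a]) := by
      rw [h, hw]; simp
    refine ⟨?_, fun d => ?_⟩
    · refine le_antisymm (occ_append_left_le _ _) ?_
      rw [e, hcz.1]
      have := occ_append_left_le (T := T) (c :: leftClosure T x) (x ++ [a])
      simpa [hw] using this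
    · rw [e]; exact hcz.2 d
  have hy : 1 ≤ occ T (c :: (w ++ [a])) := by
    have h1 := occ_append_left_le (T := T) q (c :: (w ++ [a]))
    have e : q ++ c :: (w ++ [a]) = leftClosure T (x ++ [a]) ++ (x ++ [a]) := by
      rw [h, hw]; simp
    rw [e, hcz.1] at h1
    omega
  obtain ⟨z, hzk, -, hzy⟩ := exists_isKey_closureHead (T := T) (by simp) hy (by
    intro d u t hdu ht hocc
    simp only [List.cons.injEq] at hdu
    obtain ⟨rfl, hdu⟩ := hdu
    obtain ⟨t', b, rfl⟩ := (List.eq_nil_or_concat t).resolve_left ht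
    rw [List.concat_eq_append, ← List.append_assoc] at hdu
    obtain ⟨hwu, -⟩ := List.append_inj' hdu rfl
    have := occ_append_left_eq_append (T := T) (x := [c]) (y := u) t' hocc
    rw [← hwu] at this
    exact (hcx.2 c).ne this)
  refine Or.inl ⟨z, hzk, ?_⟩
  rw [hzy, closureHead, hq.eq_leftClosure hy]
  simp

theorem IsKey.closureHead_splits {z : List α} (hz : IsKey T z) :
    (∃ a, closureHead T z = [a]) ∨
      ∃ u v, IsPiece T u ∧ IsPiece T v ∧ closureHead T z = u ++ v := by
  induction hn : z.length using Nat.strong_induction_on generalizing z with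
  | _ n ih =>
  subst hn
  obtain ⟨x, a, rfl, hpos, hlt, hmin⟩ := id hz
  have hx : 1 ≤ occ T x := hpos.trans hlt.le
  obtain ⟨v, hv⟩ := (isLeftClosure_leftClosure hpos).suffix
    (occ_append_left_eq_append [a] (isLeftClosure_leftClosure hx).1) hpos
  rcases List.eq_nil_or_concat x with rfl | ⟨x', b, hxb⟩
  · by_cases hvn : v = []
    · left
      refine ⟨a, ?_⟩
      rw [closureHead, ← hv, leftClosure_nil, hvn]; simp
    · right
      refine ⟨v, [a], isPiece_of_leftClosure_eq hpos hvn hv.symm, Or.inr ⟨a, rfl, hz⟩, ?_⟩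
      rw [closureHead, ← hv, leftClosure_nil]; simp
  · have hxne : x ≠ [] := by simp [hxb]
    have hhead : closureHead T (x ++ [a]) = v ++ closureHead T x := by
      rw [closureHead, ← hv, closureHead, List.append_assoc]
      obtain ⟨c, t, rfl⟩ := List.exists_cons_of_ne_nil hxne
      simp
    obtain ⟨z', hk, hpre, heq⟩ := exists_isKey_closureHead hxne hx (by
      rintro c u t rfl - hocc
      have h1 := occ_append_left_eq_append (T := T) (x := [c]) (y := u) t hocc
      exact (hmin c _ rfl).ne h1)
    by_cases hvn : v = []
    · rw [hhead, hvn, List.nil_append, ← heq]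
      refine ih z'.length ?_ hk rfl
      have := hpre.length_le
      simp; omega
    · right
      exact ⟨v, closureHead T x, isPiece_of_leftClosure_eq hpos hvn hv.symm,
        Or.inl ⟨z', hk, heq.symm⟩, hhead⟩

theorem isPiece_self (hT : T ≠ []) (hlast : ∀ a, T.getLast? = some a → T.count a = 1) :
    IsPiece T T := by
  obtain ⟨D, a, rfl⟩ := (List.eq_nil_or_concat T).resolve_left hT
  rw [List.concat_eq_append] at *
  have hD : a ∉ D := by
    have := hlast a (by simp)
    simpa [List.count_eq_zero] using this
  have hpos : 1 ≤ occ (D ++ [a]) [a] := occ_pos_iff.2 ⟨D, [], by simp⟩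
  have hcl : IsLeftClosure (D ++ [a]) [a] D := by
    have h1 : occ (D ++ [a]) (D ++ [a]) = occ (D ++ [a]) [a] := by
      rw [occ_append_left_eq_iff]
      intro p s h
      rcases List.eq_nil_or_concat s with rfl | ⟨s', b, rfl⟩
      · rw [(List.append_inj' h rfl).1]
      · rw [List.concat_eq_append, ← List.append_assoc, ← List.append_assoc] at h
        have := (List.append_inj' h rfl).1
        simp [this] at hD
    refine ⟨h1, fun c => ?_⟩
    by_contra! h
    have := length_le_of_occ_pos ((h1 ▸ hpos).trans h)
    simp at this
  refine Or.inl ⟨[a], isKey_singleton hpos, ?_⟩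
  rw [closureHead, hcl.eq_leftClosure hpos]
  simp

end LeftClosure

section Counting

variable {α : Type*} [DecidableEq α] {T : List α}

theorem finite_setOf_occ_pos (T : List α) : {x | 1 ≤ occ T x}.Finite := by
  refine T.sublists.toFinset.finite_toSet.subset fun x hx => ?_
  obtain ⟨p, s, hT⟩ := occ_pos_iff.1 hx
  have : x <:+: T := ⟨p, s, by simpa using hT.symm⟩
  simpa using this.sublist

theorem finite_rightExtSet (T : List α) : (RightExtSet T).Finite :=
  (finite_setOf_occ_pos T).subset fun _ ⟨_, _, _, _, h⟩ => h

theorem finite_setOf_isKey (T : List α) : {z | IsKey T z}.Finite :=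
  (finite_setOf_occ_pos T).subset fun _ h => h.occ_pos

theorem isMaxRep_leftClosure_append {x : List α} {a : α} (hpos : 1 ≤ occ T (x ++ [a]))
    (hlt : occ T (x ++ [a]) < occ T x) : IsMaxRep T (leftClosure T x ++ x) := by
  obtain ⟨h1, h2⟩ := isLeftClosure_leftClosure (hpos.trans hlt.le)
  refine ⟨by omega, fun b => ⟨?_, h2 b⟩⟩
  rw [h1, List.append_assoc]
  refine (occ_append_left_le _ _).trans_lt (lt_of_le_of_ne (occ_append_right_le _ _) fun hb => ?_)
  obtain ⟨p, s, hT⟩ := occ_pos_iff.1 hpos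
  have hpre := occ_append_right_eq_iff.1 hb p ([a] ++ s) (by simpa using hT)
  obtain rfl : b = a := by simpa using hpre
  omega

/-- Two left-minimal strings with the same left-closed extension are equal. -/
theorem eq_of_suffix_of_occ_eq {x y : List α} (h : x <:+ y) (hocc : occ T x = occ T y)
    (hmin : ∀ c t, y = c :: t → occ T y < occ T t) : x = y := by
  obtain ⟨p, rfl⟩ := h
  cases p with
  | nil => rfl
  | cons c p =>
    have h1 := hmin c (p ++ x) rfl
    have h2 := occ_append_left_le (T := T) p x
    omega

theorem ncard_setOf_isKey_le (T : List α) : {z | IsKey T z}.ncard ≤ (RightExtSet T).ncard := by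
  refine Set.ncard_le_ncard_of_injOn (fun z => leftClosure T z.dropLast ++ z) ?_ ?_
    (finite_rightExtSet T)
  · rintro _ ⟨x, a, rfl, hpos, hlt, -⟩
    refine ⟨leftClosure T x ++ x, a, isMaxRep_leftClosure_append hpos hlt, by simp, ?_⟩
    have h := (isLeftClosure_leftClosure (hpos.trans hlt.le)).1
    simpa [occ_append_left_eq_append [a] h] using hpos
  · rintro _ ⟨x, a, rfl, hpos, hlt, hmin⟩ _ ⟨y, b, rfl, hpos', hlt', hmin'⟩ heq
    simp only [List.dropLast_concat, ← List.append_assoc] at heq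
    obtain ⟨hw, hab⟩ := List.append_inj' heq rfl
    have hx := (isLeftClosure_leftClosure (hpos.trans hlt.le)).1
    have hy := (isLeftClosure_leftClosure (hpos'.trans hlt'.le)).1
    have hocc : occ T x = occ T y := by rw [← hx, ← hy, hw]
    have hxy : x = y := by
      rcases List.suffix_or_suffix_of_suffix (List.suffix_append (leftClosure T x) x)
        (hw ▸ List.suffix_append (leftClosure T y) y) with h | h
      · exact eq_of_suffix_of_occ_eq h hocc hmin'
      · exact (eq_of_suffix_of_occ_eq h hocc.symm hmin).symm
    rw [hxy, hab]

theorem exists_finset_isPiece (T : List α) :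
    ∃ S : Finset (List α), (∀ s, s ∈ S ↔ IsPiece T s) ∧ S.card ≤ 2 * (RightExtSet T).ncard := by
  have hfin := finite_setOf_isKey T
  refine ⟨hfin.toFinset.image (closureHead T) ∪ hfin.toFinset.filter (·.length = 1), ?_, ?_⟩
  · intro s
    simp only [Finset.mem_union, Finset.mem_image, Finset.mem_filter, Set.Finite.mem_toFinset,
      Set.mem_ofPred_eq, IsPiece, List.length_eq_one_iff]
    constructor
    · rintro (⟨z, hz, rfl⟩ | ⟨hs, a, rfl⟩)
      · exact Or.inl ⟨z, hz, rfl⟩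
      · exact Or.inr ⟨a, rfl, hs⟩
    · rintro (⟨z, hz, rfl⟩ | ⟨a, rfl, hs⟩)
      · exact Or.inl ⟨z, hz, rfl⟩
      · exact Or.inr ⟨hs, a, rfl⟩
  · have h := ncard_setOf_isKey_le T
    rw [Set.ncard_eq_toFinset_card _ hfin] at h
    have h1 := Finset.card_union_le (hfin.toFinset.image (closureHead T))
      (hfin.toFinset.filter (·.length = 1))
    have h2 := Finset.card_image_le (s := hfin.toFinset) (f := closureHead T)
    have h3 := Finset.card_filter_le hfin.toFinset (·.length = 1)
    omega

end Counting

section Grammar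

variable {σ : Type}

/-- The string denoted by a sentential form whose nonterminals are themselves strings. -/
def flattenSymbols (u : List (Symbol σ (List σ))) : List σ :=
  u.flatMap fun
    | .terminal a => [a]
    | .nonterminal x => x

theorem flattenSymbols_append (u v : List (Symbol σ (List σ))) :
    flattenSymbols (u ++ v) = flattenSymbols u ++ flattenSymbols v :=
  List.flatMap_append

theorem flattenSymbols_map_terminal (w : List σ) :
    flattenSymbols (w.map Symbol.terminal) = w := by
  induction w with
  | nil => rfl
  | cons a w ih => exact congrArg (a :: ·) ih

/-- A finite set of nonempty strings, each a single character or a concatenation of two members,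
yields a grammar in Chomsky normal form for each of its members. -/
theorem exists_grammar_of_splits (S : Finset (List σ)) {T : List σ} (hT : T ∈ S)
    (hne : ∀ s ∈ S, s ≠ [])
    (hS : ∀ s ∈ S, (∃ a, s = [a]) ∨ ∃ u v, u ∈ S ∧ v ∈ S ∧ s = u ++ v) :
    ∃ g : ContextFreeGrammar σ, InChomskyNF g ∧ g.rules.card ≤ S.card ∧ g.language = {T} := by
  classical
  have hout : ∀ s : List σ, ∃ o : List (Symbol σ (List σ)), s ∈ S →
      (∃ a, s = [a] ∧ o = [Symbol.terminal a]) ∨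
      ∃ u v, u ∈ S ∧ v ∈ S ∧ s = u ++ v ∧ o = [Symbol.nonterminal u, Symbol.nonterminal v] := by
    intro s
    by_cases hs : s ∈ S
    · rcases hS s hs with ⟨a, ha⟩ | ⟨u, v, hu, hv, h⟩
      · exact ⟨_, fun _ => Or.inl ⟨a, ha, rfl⟩⟩
      · exact ⟨_, fun _ => Or.inr ⟨u, v, hu, hv, h, rfl⟩⟩
    · exact ⟨[], fun h => absurd h hs⟩
  choose out hout using hout
  let g : ContextFreeGrammar σ := ⟨List σ, T, S.image fun s => ⟨s, out s⟩⟩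
  have hrule : ∀ s ∈ S, g.Derives [Symbol.nonterminal s] (out s) := fun s hs =>
    ContextFreeGrammar.Produces.single ⟨⟨s, out s⟩, Finset.mem_image_of_mem _ hs,
      ContextFreeRule.Rewrites.input_output⟩
  have hgen : ∀ n : ℕ, ∀ s ∈ S, s.length ≤ n →
      g.Derives [Symbol.nonterminal s] (s.map Symbol.terminal) := by
    intro n
    induction n with
    | zero => exact fun s hs hn => absurd (List.length_eq_zero_iff.1 (Nat.le_zero.1 hn)) (hne s hs)
    | succ n ih =>
      intro s hs hn
      refine (hrule s hs).trans ?_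
      rcases hout s hs with ⟨a, rfl, ho⟩ | ⟨u, v, hu, hv, rfl, ho⟩
      · rw [ho]; exact ContextFreeGrammar.Derives.refl _
      · have hul := List.length_pos_iff.2 (hne u hu)
        have hvl := List.length_pos_iff.2 (hne v hv)
        rw [List.length_append] at hn
        rw [ho, List.map_append]
        exact ((ih u hu (by omega)).append_right [Symbol.nonterminal v]).trans
          ((ih v hv (by omega)).append_left (u.map Symbol.terminal))
  have hsound : ∀ u v : List (Symbol σ (List σ)), g.Derives u v →
      flattenSymbols u = flattenSymbols v := by
    intro u v h
    induction h with
    | refl => rfl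
    | tail _ hstep ih =>
      rw [ih]
      obtain ⟨r, hr, hrw⟩ := hstep
      obtain ⟨s, hs, rfl⟩ := Finset.mem_image.1 hr
      obtain ⟨p, q, rfl, rfl⟩ := hrw.exists_parts
      have hflat : flattenSymbols [Symbol.nonterminal s] = flattenSymbols (out s) := by
        rcases hout s hs with ⟨a, rfl, ho⟩ | ⟨u, v, -, -, rfl, ho⟩ <;>
          simp [ho, flattenSymbols]
      rw [flattenSymbols_append, flattenSymbols_append, flattenSymbols_append,
        flattenSymbols_append, hflat]
  refine ⟨g, ?_, Finset.card_image_le, ?_⟩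
  · intro r hr
    obtain ⟨s, hs, rfl⟩ := Finset.mem_image.1 hr
    rcases hout s hs with ⟨a, -, ho⟩ | ⟨u, v, -, -, -, ho⟩
    · exact Or.inl ⟨a, ho⟩
    · exact Or.inr ⟨u, v, ho⟩
  · ext w
    constructor
    · intro hw
      have := hsound _ _ hw
      rw [flattenSymbols_map_terminal] at this
      exact Set.mem_singleton_iff.2 (by simpa [flattenSymbols, g] using this.symm)
    · rintro rfl
      exact hgen _ w hT le_rfl

end Grammar

theorem stmt13 :
    ∃ c : ℕ, 0 < c ∧
      ∀ (σ : Type) (_ : Fintype σ) (_ : DecidableEq σ) (T : List σ),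
        1 ≤ T.length →
        (∀ a : σ, T.getLast? = some a → T.count a = 1) →
        ∃ g : ContextFreeGrammar σ,
          InChomskyNF g ∧
          g.rules.card ≤ c * ((RightExtSet T).ncard + (LeftExtSet T).ncard) ∧
          g.language = {T} := by
  refine ⟨2, by norm_num, fun σ _ _ T hlen hlast => ?_⟩
  obtain ⟨S, hS, hcard⟩ := exists_finset_isPiece T
  have hT : T ≠ [] := List.length_pos_iff.1 hlen
  obtain ⟨g, hg, hle, hlang⟩ := exists_grammar_of_splits S ((hS T).2 (isPiece_self hT hlast))
    (fun s hs => ((hS s).1 hs).ne_nil) (by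
      intro s hs
      rcases (hS s).1 hs with ⟨z, hz, rfl⟩ | ⟨a, rfl, -⟩
      · simpa only [hS] using hz.closureHead_splits
      · exact Or.inl ⟨a, rfl⟩)
  exact ⟨g, hg, by omega, hlang⟩
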